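/- Let f ∈ Q̄[X,Y] be an irreducible polynomial which is not a monomial, defining the curve C = {(x,y) ∈ (Q̄^×)² : f(x,y)=0}. Then the tangent map σ_C is constant on the smooth points of C — i.e. there exists a point (α:β) ∈ P¹(Q̄) such that (x·(∂f/∂X)(P) : y·(∂f/∂Y)(P)) = (α:β) for every smooth point P = (x,y) of C — if and only if C is a translate of a subtorus, i.e. C = {(x,y) ∈ (Q̄^×)² : x^a y^b = c} for some (a,b) ∈ ℤ² ∖ {(0,0)} and c ∈ Q̄^×. -/

import Mathlib

open NumberField IsDedekindDomain MvPolynomial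
open scoped Classical

/-- `Qbar` is the field of algebraic numbers, the algebraic closure of `ℚ`. -/
noncomputable abbrev Qbar : Type := AlgebraicClosure ℚ

/-- The curve in the torus `G_m²` cut out by a polynomial `f ∈ Qbar[X,Y]`:
the set of points `(x,y)` with `x, y ≠ 0` and `f(x,y) = 0`. -/
def curve (f : MvPolynomial (Fin 2) Qbar) : Set (Qbar × Qbar) :=
  {P | P.1 ≠ 0 ∧ P.2 ≠ 0 ∧ MvPolynomial.eval ![P.1, P.2] f = 0}

/-- A subset `C` of the torus `G_m²` is a translate of a subtorus if it is of the form
`{(x,y) : x^a y^b = c}` for some `(a,b) ∈ ℤ² \ {(0,0)}` and some `c ∈ Qbar^×`. -/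
def IsSubtorusTranslate (C : Set (Qbar × Qbar)) : Prop :=
  ∃ (a b : ℤ) (c : Qbar), ¬(a = 0 ∧ b = 0) ∧ c ≠ 0 ∧
    C = {P | P.1 ≠ 0 ∧ P.2 ≠ 0 ∧ P.1 ^ a * P.2 ^ b = c}

section TorusCurves

variable {K : Type*} [Field K]

theorem zpow_mul_pow_toNat_neg {x : K} (hx : x ≠ 0) (a : ℤ) :
    x ^ a * x ^ (-a).toNat = x ^ a.toNat := by
  rw [← zpow_natCast, ← zpow_natCast, ← zpow_add₀ hx]
  congr 1
  omega

/-- The coefficient of the Euler derivation `X i * ∂/∂X i`. -/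
theorem MvPolynomial.coeff_X_mul_pderiv {σ R : Type*} [CommSemiring R] (i : σ)
    (f : MvPolynomial σ R) (m : σ →₀ ℕ) :
    coeff m (X i * pderiv i f) = m i * coeff m f := by
  classical
  rw [coeff_X_mul']
  split_ifs with h
  · have hm : m i ≠ 0 := Finsupp.mem_support_iff.mp h
    rw [coeff_pderiv]
    have h1 : m - Finsupp.single i 1 + Finsupp.single i 1 = m := by
      apply tsub_add_cancel_of_le
      rw [Finsupp.single_le_iff]
      omega
    rw [h1, mul_comm]
    congr 1
    have h2 := DFunLike.congr_fun h1 i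
    simp only [Finsupp.add_apply, Finsupp.single_eq_same] at h2
    rw [← h2]
    push_cast
    rfl
  · simp [Finsupp.notMem_support_iff.mp h]

theorem MvPolynomial.not_dvd_X_of_irreducible {σ : Type*} {f : MvPolynomial σ K}
    (hirr : Irreducible f) (hmon : ¬ ∃ (c : K) (m : σ →₀ ℕ), f = monomial m c) (i : σ) :
    ¬ f ∣ X i := by
  intro h
  rw [X, dvd_monomial_one_iff_exists] at h
  obtain ⟨m, u, -, -, rfl⟩ := h
  exact hmon ⟨_, _, rfl⟩

/-- Nullstellensatz for irreducible plane curves in the torus. -/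
theorem MvPolynomial.dvd_of_forall_torus_eval_eq_zero [IsAlgClosed K]
    {f p : MvPolynomial (Fin 2) K} (hirr : Irreducible f)
    (hmon : ¬ ∃ (c : K) (m : Fin 2 →₀ ℕ), f = monomial m c)
    (h : ∀ x y : K, x ≠ 0 → y ≠ 0 → eval ![x, y] f = 0 → eval ![x, y] p = 0) : f ∣ p := by
  have hprime : Prime f := hirr.prime
  have hP : (Ideal.span {f}).IsPrime := (Ideal.span_singleton_prime hirr.ne_zero).mpr hprime
  have key : X 0 * X 1 * p ∈ Ideal.span {f} := by
    rw [← IsPrime.vanishingIdeal_zeroLocus (K := K) (Ideal.span {f})]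
    intro v hv
    have hv0 : eval v f = 0 := by
      simpa [aeval_eq_eval] using hv f (Ideal.mem_span_singleton_self f)
    have hv2 : v = ![v 0, v 1] := by
      ext i; fin_cases i <;> rfl
    have hvp := h (v 0) (v 1)
    rw [← hv2] at hvp
    simp only [aeval_eq_eval, map_mul, eval_X]
    by_cases h0 : v 0 = 0
    · simp [h0]
    by_cases h1 : v 1 = 0
    · simp [h1]
    simp [hvp h0 h1 hv0]
  rw [Ideal.mem_span_singleton] at key
  rcases hprime.dvd_or_dvd key with h1 | h1
  · rcases hprime.dvd_or_dvd h1 with h2 | h2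
    · exact absurd h2 (not_dvd_X_of_irreducible hirr hmon 0)
    · exact absurd h2 (not_dvd_X_of_irreducible hirr hmon 1)
  · exact h1

/-- The binomial cutting out `x ^ a * y ^ b = c` in the torus. -/
noncomputable def torusBinomial (a b : ℤ) (c : K) : MvPolynomial (Fin 2) K :=
  X 0 ^ a.toNat * X 1 ^ b.toNat - C c * (X 0 ^ (-a).toNat * X 1 ^ (-b).toNat)

theorem eval_torusBinomial {x y : K} (hx : x ≠ 0) (hy : y ≠ 0) (a b : ℤ) (c : K) :
    eval ![x, y] (torusBinomial a b c) =
      (x ^ a * y ^ b - c) * (x ^ (-a).toNat * y ^ (-b).toNat) := by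
  simp only [torusBinomial, map_sub, map_mul, map_pow, eval_X, eval_C, Matrix.cons_val_zero,
    Matrix.cons_val_one, ← zpow_mul_pow_toNat_neg hx a, ← zpow_mul_pow_toNat_neg hy b]
  ring

theorem eval_torusBinomial_eq_zero_iff {x y : K} (hx : x ≠ 0) (hy : y ≠ 0) (a b : ℤ) (c : K) :
    eval ![x, y] (torusBinomial a b c) = 0 ↔ x ^ a * y ^ b = c := by
  rw [eval_torusBinomial hx hy, mul_eq_zero, sub_eq_zero, or_iff_left]
  exact mul_ne_zero (pow_ne_zero _ hx) (pow_ne_zero _ hy)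

theorem mul_natCast_mul_pow_pred (n : ℕ) (x : K) : x * (n * x ^ (n - 1)) = n * x ^ n := by
  cases n with
  | zero => simp
  | succ n => simp only [Nat.add_sub_cancel]; ring

theorem natCast_toNat_sub (a : ℤ) : ((a.toNat : K) - ((-a).toNat : K)) = (a : K) := by
  have h : ((a.toNat : ℤ) - ((-a).toNat : ℤ)) = a := by omega
  exact_mod_cast congrArg (Int.cast : ℤ → K) h

theorem mul_eval_pderiv_zero_torusBinomial {x y : K} (hx : x ≠ 0) (hy : y ≠ 0) (a b : ℤ) {c : K}
    (h : x ^ a * y ^ b = c) :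
    x * eval ![x, y] (pderiv 0 (torusBinomial a b c)) = a * (x ^ a.toNat * y ^ b.toNat) := by
  have h1 : x * eval ![x, y] (pderiv 0 (torusBinomial a b c)) =
      (x * (a.toNat * x ^ (a.toNat - 1))) * y ^ b.toNat -
        c * ((x * ((-a).toNat * x ^ ((-a).toNat - 1))) * y ^ (-b).toNat) := by
    simp [torusBinomial]
    ring
  rw [h1, mul_natCast_mul_pow_pred, mul_natCast_mul_pow_pred, ← natCast_toNat_sub (K := K) a,
    ← h, ← zpow_mul_pow_toNat_neg hx a, ← zpow_mul_pow_toNat_neg hy b]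
  ring

theorem mul_eval_pderiv_one_torusBinomial {x y : K} (hx : x ≠ 0) (hy : y ≠ 0) (a b : ℤ) {c : K}
    (h : x ^ a * y ^ b = c) :
    y * eval ![x, y] (pderiv 1 (torusBinomial a b c)) = b * (x ^ a.toNat * y ^ b.toNat) := by
  have h1 : y * eval ![x, y] (pderiv 1 (torusBinomial a b c)) =
      (y * (b.toNat * y ^ (b.toNat - 1))) * x ^ a.toNat -
        c * ((y * ((-b).toNat * y ^ ((-b).toNat - 1))) * x ^ (-a).toNat) := by
    simp [torusBinomial]
    ring
  rw [h1, mul_natCast_mul_pow_pred, mul_natCast_mul_pow_pred, ← natCast_toNat_sub (K := K) b,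
    ← h, ← zpow_mul_pow_toNat_neg hx a, ← zpow_mul_pow_toNat_neg hy b]
  ring

/-- On a curve contained in a translate of a subtorus, the tangent map is constant. -/
theorem tangent_eq_of_dvd_torusBinomial [CharZero K] {f : MvPolynomial (Fin 2) K} {a b : ℤ} {c : K}
    (hab : ¬(a = 0 ∧ b = 0)) (hdvd : f ∣ torusBinomial a b c) {x y : K} (hx : x ≠ 0) (hy : y ≠ 0)
    (hf : eval ![x, y] f = 0) :
    x * eval ![x, y] (pderiv 0 f) * b = y * eval ![x, y] (pderiv 1 f) * a := by
  obtain ⟨q, hq⟩ := hdvd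
  have hc : x ^ a * y ^ b = c := by
    rw [← eval_torusBinomial_eq_zero_iff hx hy, hq, map_mul, hf, zero_mul]
  have h0 := mul_eval_pderiv_zero_torusBinomial hx hy a b hc
  have h1 := mul_eval_pderiv_one_torusBinomial hx hy a b hc
  simp only [hq, pderiv_mul, map_add, map_mul, hf, zero_mul, add_zero] at h0 h1
  have hM : x ^ a.toNat * y ^ b.toNat ≠ 0 := mul_ne_zero (pow_ne_zero _ hx) (pow_ne_zero _ hy)
  have hq0 : eval ![x, y] q ≠ 0 := by
    intro h
    rw [h, mul_zero, mul_zero, eq_comm, mul_eq_zero, or_iff_left hM] at h0 h1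
    exact hab ⟨by exact_mod_cast h0, by exact_mod_cast h1⟩
  apply mul_right_cancel₀ hq0
  linear_combination (b : K) * h0 - (a : K) * h1

/-- A polynomial dividing a combination of its Euler derivatives is weighted homogeneous. -/
theorem MvPolynomial.exists_weight_of_dvd {f : MvPolynomial (Fin 2) K} {α β : K} (hf : f ≠ 0)
    (hdvd : f ∣ C β * (X 0 * pderiv 0 f) - C α * (X 1 * pderiv 1 f)) :
    ∃ w : K, ∀ m ∈ f.support, β * m 0 - α * m 1 = w := by
  set g := C β * (X 0 * pderiv 0 f) - C α * (X 1 * pderiv 1 f) with hg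
  have hcoeff : ∀ m, coeff m g = (β * m 0 - α * m 1) * coeff m f := by
    intro m
    rw [hg, coeff_sub, coeff_C_mul, coeff_C_mul, coeff_X_mul_pderiv, coeff_X_mul_pderiv]
    ring
  have hdeg : g.totalDegree ≤ f.totalDegree := by
    apply totalDegree_le_of_support_subset
    intro m
    rw [mem_support_iff, mem_support_iff, hcoeff]
    exact right_ne_zero_of_mul
  obtain ⟨q, hq⟩ := hdvd
  obtain ⟨w, rfl⟩ : ∃ w : K, q = C w := by
    by_cases hq0 : q = 0
    · exact ⟨0, by simp [hq0]⟩
    rw [hq, totalDegree_mul_of_isDomain hf hq0] at hdeg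
    exact ⟨_, totalDegree_eq_zero_iff_eq_C.mp (by omega)⟩
  refine ⟨w, fun m hm => ?_⟩
  apply mul_right_cancel₀ (mem_support_iff.mp hm)
  rw [← hcoeff, hq, mul_comm f, coeff_C_mul]

/-- Integer points on a rational line through the origin are multiples of a primitive vector. -/
theorem Int.exists_primitive_direction {u v : ℤ} (huv : ¬(u = 0 ∧ v = 0)) :
    ∃ a b s t : ℤ, ¬(a = 0 ∧ b = 0) ∧ ∀ p q : ℤ, p * v = q * u →
      (s * p + t * q) * a = p ∧ (s * p + t * q) * b = q := by
  have hg : 0 < Int.gcd u v := by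
    rw [Nat.pos_iff_ne_zero, Ne, Int.gcd_eq_zero_iff]
    exact huv
  obtain ⟨a, b, hab, hu, hv⟩ := Int.exists_gcd_one hg
  obtain ⟨s, t, hst⟩ := Int.isCoprime_iff_gcd_eq_one.mpr hab
  refine ⟨a, b, s, t, ?_, fun p q hpq => ?_⟩
  · rintro ⟨rfl, rfl⟩
    simp at hst
  · have hpq' : p * b = q * a := by
      have hg0 : ((Int.gcd u v : ℕ) : ℤ) ≠ 0 := by exact_mod_cast hg.ne'
      apply mul_right_cancel₀ hg0
      linear_combination hpq - p * hv + q * hu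
    constructor
    · linear_combination p * hst - t * hpq'
    · linear_combination q * hst + s * hpq'

theorem MvPolynomial.exists_direction_of_weight [CharZero K] {f : MvPolynomial (Fin 2) K}
    (hmon : ¬ ∃ (c : K) (m : Fin 2 →₀ ℕ), f = monomial m c) {α β w : K}
    (hαβ : ¬(α = 0 ∧ β = 0)) (hw : ∀ m ∈ f.support, β * m 0 - α * m 1 = w) :
    ∃ (a b : ℤ) (m₀ : Fin 2 →₀ ℕ) (k : (Fin 2 →₀ ℕ) → ℤ), ¬(a = 0 ∧ b = 0) ∧
      ∀ m ∈ f.support, (m 0 : ℤ) = m₀ 0 + k m * a ∧ (m 1 : ℤ) = m₀ 1 + k m * b := by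
  have hnt : f.support.Nontrivial := by
    by_contra h
    rcases (Set.not_nontrivial_iff.mp h).eq_empty_or_singleton with h | ⟨m, h⟩
    · exact hmon ⟨0, 0, by simpa using h⟩
    · refine hmon ⟨coeff m f, m, ?_⟩
      conv_lhs => rw [f.as_sum, Finset.coe_eq_singleton.mp h, Finset.sum_singleton]
  obtain ⟨m₀, hm₀, m₁, hm₁, hne⟩ := hnt
  have huv : ¬((m₁ 0 : ℤ) - m₀ 0 = 0 ∧ (m₁ 1 : ℤ) - m₀ 1 = 0) := by
    rintro ⟨h0, h1⟩
    apply hne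
    ext i
    fin_cases i
    · simp only [Fin.zero_eta]; omega
    · simp only [Fin.mk_one]; omega
  obtain ⟨a, b, s, t, hab, hk⟩ := Int.exists_primitive_direction huv
  refine ⟨a, b, m₀, fun m => s * (m 0 - m₀ 0) + t * (m 1 - m₀ 1), hab,
    fun m hm => ?_⟩
  have hcross : ((m 0 : ℤ) - m₀ 0) * (m₁ 1 - m₀ 1) = (m 1 - m₀ 1) * (m₁ 0 - m₀ 0) := by
    have e0 := hw m₀ hm₀
    have e1 := hw m₁ hm₁
    have e := hw m hm
    have hK : ((m 0 : K) - m₀ 0) * (m₁ 1 - m₀ 1) = (m 1 - m₀ 1) * (m₁ 0 - m₀ 0) := by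
      by_cases hβ : β = 0
      · have hα : α ≠ 0 := fun hα => hαβ ⟨hα, hβ⟩
        apply mul_left_cancel₀ hα
        linear_combination ((m₁ 0 : K) - m₀ 0) * (e - e0) - ((m 0 : K) - m₀ 0) * (e1 - e0)
      · apply mul_left_cancel₀ hβ
        linear_combination ((m₁ 1 : K) - m₀ 1) * (e - e0) - ((m 1 : K) - m₀ 1) * (e1 - e0)
    exact_mod_cast hK
  obtain ⟨h0, h1⟩ := hk _ _ hcross
  exact ⟨by linear_combination -h0, by linear_combination -h1⟩

/-- A polynomial supported on a line is, on the torus, a one-variable polynomial in a character,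
up to monomials. -/
theorem MvPolynomial.exists_polynomial_of_support_line {f : MvPolynomial (Fin 2) K} {a b : ℤ}
    {m₀ : Fin 2 →₀ ℕ} {k : (Fin 2 →₀ ℕ) → ℤ} (hf : f ≠ 0)
    (hk : ∀ m ∈ f.support, (m 0 : ℤ) = m₀ 0 + k m * a ∧ (m 1 : ℤ) = m₀ 1 + k m * b) :
    ∃ h : Polynomial K, h ≠ 0 ∧ ∀ x y : K, x ≠ 0 → y ≠ 0 →
      (eval ![x, y] f = 0 ↔ h.eval (x ^ a * y ^ b) = 0) := by
  obtain ⟨N, hN⟩ : ∃ N : ℕ, ∀ m ∈ f.support, 0 ≤ k m + N := by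
    refine ⟨∑ m ∈ f.support, (k m).natAbs, fun m hm => ?_⟩
    have := Finset.single_le_sum (f := fun m => (k m).natAbs) (fun _ _ => Nat.zero_le _) hm
    omega
  have hinj : ∀ m ∈ f.support, ∀ m' ∈ f.support, (k m + N).toNat = (k m' + N).toNat → m = m' := by
    intro m hm m' hm' h
    have h1 := hN m hm
    have h2 := hN m' hm'
    have hkk : k m = k m' := by omega
    have e := hk m hm
    have e' := hk m' hm'
    rw [hkk] at e
    ext i
    fin_cases i
    · simp only [Fin.zero_eta]; omega
    · simp only [Fin.mk_one]; omega
  refine ⟨∑ m ∈ f.support, Polynomial.monomial (k m + N).toNat (coeff m f), ?_, ?_⟩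
  · obtain ⟨m, hm⟩ := support_nonempty.mpr hf
    intro h
    have h1 := congrArg (Polynomial.coeff · (k m + N).toNat) h
    simp only [Polynomial.finsetSum_coeff, Polynomial.coeff_monomial, Polynomial.coeff_zero] at h1
    rw [Finset.sum_eq_single m] at h1
    · exact mem_support_iff.mp hm (by simpa using h1)
    · intro m' hm' hne
      exact if_neg fun h => hne (hinj _ hm' _ hm h)
    · exact fun h => absurd hm h
  · intro x y hx hy
    set T := x ^ a * y ^ b with hT
    have hT0 : T ≠ 0 := mul_ne_zero (zpow_ne_zero _ hx) (zpow_ne_zero _ hy)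
    have key : (x ^ m₀ 0 * y ^ m₀ 1) *
        (∑ m ∈ f.support, Polynomial.monomial (k m + N).toNat (coeff m f)).eval T =
        T ^ N * eval ![x, y] f := by
      rw [eval_eq', Polynomial.eval_finsetSum, Finset.mul_sum, Finset.mul_sum]
      refine Finset.sum_congr rfl fun m hm => ?_
      have hTk : T ^ (k m + N).toNat = (x ^ (k m * a) * y ^ (k m * b)) * T ^ N := by
        rw [← zpow_natCast, Int.toNat_of_nonneg (hN m hm), zpow_add₀ hT0, zpow_natCast, hT,
          mul_zpow, ← zpow_mul, ← zpow_mul, mul_comm a, mul_comm b]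
      have hx' : x ^ m 0 = x ^ m₀ 0 * x ^ (k m * a) := by
        rw [← zpow_natCast, (hk m hm).1, zpow_add₀ hx, zpow_natCast]
      have hy' : y ^ m 1 = y ^ m₀ 1 * y ^ (k m * b) := by
        rw [← zpow_natCast, (hk m hm).2, zpow_add₀ hy, zpow_natCast]
      simp only [Polynomial.eval_monomial, Fin.prod_univ_two, Matrix.cons_val_zero,
        Matrix.cons_val_one, hTk, hx', hy']
      ring
    have hm0 : x ^ m₀ 0 * y ^ m₀ 1 ≠ 0 := mul_ne_zero (pow_ne_zero _ hx) (pow_ne_zero _ hy)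
    constructor
    · intro h
      rw [h, mul_zero] at key
      exact (mul_eq_zero.mp key).resolve_left hm0
    · intro h
      rw [h, mul_zero, eq_comm] at key
      exact (mul_eq_zero.mp key).resolve_left (pow_ne_zero _ hT0)

/-- An irreducible curve cut out on the torus by a polynomial in a character is a single fibre of
that character. -/
theorem exists_fibre_of_eval_iff [IsAlgClosed K] {f : MvPolynomial (Fin 2) K} (hirr : Irreducible f)
    (hmon : ¬ ∃ (c : K) (m : Fin 2 →₀ ℕ), f = monomial m c) {a b : ℤ} {h : Polynomial K}
    (h0 : h ≠ 0)
    (hf : ∀ x y : K, x ≠ 0 → y ≠ 0 → (eval ![x, y] f = 0 ↔ h.eval (x ^ a * y ^ b) = 0)) :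
    ∃ c : K, c ≠ 0 ∧ ∀ x y : K, x ≠ 0 → y ≠ 0 → (eval ![x, y] f = 0 ↔ x ^ a * y ^ b = c) := by
  classical
  have hdvd : f ∣ ∏ c ∈ h.roots.toFinset.erase 0, torusBinomial a b c := by
    apply dvd_of_forall_torus_eval_eq_zero hirr hmon
    intro x y hx hy hxy
    rw [map_prod]
    apply Finset.prod_eq_zero (i := x ^ a * y ^ b)
    · rw [Finset.mem_erase, Multiset.mem_toFinset, Polynomial.mem_roots h0]
      exact ⟨mul_ne_zero (zpow_ne_zero _ hx) (zpow_ne_zero _ hy), (hf x y hx hy).mp hxy⟩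
    · rw [eval_torusBinomial_eq_zero_iff hx hy]
  obtain ⟨c, hc, q, hq⟩ := (hirr.prime.dvd_finsetProd_iff _).mp hdvd
  rw [Finset.mem_erase, Multiset.mem_toFinset, Polynomial.mem_roots h0] at hc
  refine ⟨c, hc.1, fun x y hx hy => ⟨fun hxy => ?_, fun hxy => ?_⟩⟩
  · rw [← eval_torusBinomial_eq_zero_iff hx hy, hq, map_mul, hxy, zero_mul]
  · rw [hf x y hx hy, hxy]
    exact hc.2

end TorusCurves

/-- **Proposition (constancy of the tangent map characterizes translates of subtori).**
Let `f ∈ Qbar[X,Y]` be irreducible and not a monomial, defining the curve `C` in `G_m²`.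
The tangent map `σ_C`, sending a smooth point `P=(x,y)` of `C` to
`(x·(∂f/∂X)(P) : y·(∂f/∂Y)(P)) ∈ P¹(Qbar)`, is constant — i.e. there is `(α:β) ∈ P¹(Qbar)`
with `σ_C(P) = (α:β)` (projective equality: `x·(∂f/∂X)(P)·β = y·(∂f/∂Y)(P)·α`) for every
smooth point `P` of `C` — if and only if `C` is a translate of a subtorus. -/
theorem tangent_map_constant_iff_subtorus_translate
    (f : MvPolynomial (Fin 2) Qbar) (hirr : Irreducible f)
    (hmon : ¬ ∃ (c : Qbar) (m : Fin 2 →₀ ℕ), f = MvPolynomial.monomial m c) :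
    (∃ α β : Qbar, ¬(α = 0 ∧ β = 0) ∧
      ∀ x y : Qbar, x ≠ 0 → y ≠ 0 → MvPolynomial.eval ![x, y] f = 0 →
        ¬(MvPolynomial.eval ![x, y] (MvPolynomial.pderiv 0 f) = 0 ∧
          MvPolynomial.eval ![x, y] (MvPolynomial.pderiv 1 f) = 0) →
        x * MvPolynomial.eval ![x, y] (MvPolynomial.pderiv 0 f) * β
          = y * MvPolynomial.eval ![x, y] (MvPolynomial.pderiv 1 f) * α) ↔
    IsSubtorusTranslate (curve f) := by
  constructor
  · rintro ⟨α, β, hαβ, h⟩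
    have hdvd : f ∣ C β * (X 0 * pderiv 0 f) - C α * (X 1 * pderiv 1 f) := by
      apply dvd_of_forall_torus_eval_eq_zero hirr hmon
      intro x y hx hy hxy
      simp only [map_sub, map_mul, eval_C, eval_X, Matrix.cons_val_zero, Matrix.cons_val_one]
      by_cases hs : eval ![x, y] (pderiv 0 f) = 0 ∧ eval ![x, y] (pderiv 1 f) = 0
      · simp [hs.1, hs.2]
      · linear_combination h x y hx hy hxy hs
    obtain ⟨w, hw⟩ := exists_weight_of_dvd hirr.ne_zero hdvd
    obtain ⟨a, b, m₀, k, hab, hk⟩ := exists_direction_of_weight hmon hαβ hw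
    obtain ⟨p, hp0, hp⟩ := exists_polynomial_of_support_line hirr.ne_zero hk
    obtain ⟨c, hc, hfc⟩ := exists_fibre_of_eval_iff hirr hmon hp0 hp
    refine ⟨a, b, c, hab, hc, Set.ext fun P => ?_⟩
    exact and_congr_right fun hx => and_congr_right fun hy => hfc P.1 P.2 hx hy
  · rintro ⟨a, b, c, hab, -, hC⟩
    refine ⟨a, b, by exact_mod_cast hab, fun x y hx hy hxy _ => ?_⟩
    refine tangent_eq_of_dvd_torusBinomial (c := c) hab ?_ hx hy hxy
    apply dvd_of_forall_torus_eval_eq_zero hirr hmon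
    intro x y hx hy hxy
    have hmem : (x, y) ∈ curve f := ⟨hx, hy, hxy⟩
    rw [hC] at hmem
    exact (eval_torusBinomial_eq_zero_iff hx hy a b c).mpr hmem.2.2
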